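/- arXiv:2106.00552 — 11 statements merged into one kernel-verified Lean document; each statement's English description precedes it below -/
import Mathlib

section
/- Let u_1,…,u_m (m ≥ 1) be elements of A as in the context, with scalars p_{i,j}. Define the R-bracket of homogeneous elements by [u,v]_R = p_{u,v}·uv − p_{v,u}·vu, where p between products of the u's is extended multiplicatively, and let [u_1,…,u_m]_R denote the nested bracket [u_1,[u_2,…,[u_{m−1},u_m]_R…]_R]_R. Then [u_1,…,u_m]_R = (∏_{j=1}^{m−1} (∏_{l=j+1}^{m} p_{l,j}) · ((∏_{l=j+1}^{m} p_{j,l})^3 − 1)) · u_m u_{m−1} ⋯ u_1. -/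
/-- The nested R-bracket `[u_j, u_{j+1}, …, u_{j+k}]_R`, where the bicharacter `p`
is extended multiplicatively to products of the `u`'s. -/
noncomputable def nestedBracketR {F A : Type*} [Field F] [Ring A] [Algebra F A]
    (u : ℕ → A) (p : ℕ → ℕ → F) : ℕ → ℕ → A
  | j, 0 => u j
  | j, k + 1 =>
      (∏ l ∈ Finset.Icc (j + 1) (j + k + 1), p j l) • (u j * nestedBracketR u p (j + 1) k)
        - (∏ l ∈ Finset.Icc (j + 1) (j + k + 1), p l j) • (nestedBracketR u p (j + 1) k * u j)

theorem aux_prod {F : Type*} [CommMonoid F] (f : ℕ → F) (a b c : ℕ) (hc : c = a + 1) (h : a ≤ b) :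
    ∏ l ∈ Finset.Icc a b, f l = f a * ∏ l ∈ Finset.Icc c b, f l := by
  subst hc
  have : Finset.Icc a b = insert a (Finset.Icc (a + 1) b) := by
    ext x; simp only [Finset.mem_insert, Finset.mem_Icc]; omega
  rw [this, Finset.prod_insert (by simp)]

theorem aux_comm {F A : Type*} [Field F] [Ring A] [Algebra F A]
    (m : ℕ) (u : ℕ → A) (p : ℕ → ℕ → F)
    (hcomm : ∀ i ∈ Finset.Icc 1 m, ∀ j ∈ Finset.Icc 1 m, u i * u j = p i j • (u j * u i))
    (j : ℕ) (hj : j ∈ Finset.Icc 1 m) (n : ℕ) (hn : n ≤ m) :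
    u j * ((List.range n).map (fun i => u (m - i))).prod =
      (∏ l ∈ Finset.Icc (m - n + 1) m, p j l) •
        (((List.range n).map (fun i => u (m - i))).prod * u j) := by
  induction n with
  | zero => simp
  | succ n ih =>
    have ih := ih (by omega)
    rw [aux_prod (p j) (m - (n + 1) + 1) m (m - n + 1) (by omega) (by omega)]
    have e : m - (n + 1) + 1 = m - n := by omega
    have hc := hcomm j hj (m - n) (by simp only [Finset.mem_Icc]; omega)
    rw [e, List.range_succ, List.map_append, List.prod_append, ← mul_assoc, ih]
    simp only [List.map_cons, List.map_nil, List.prod_cons, List.prod_nil, mul_one]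
    rw [smul_mul_assoc, mul_assoc, hc, mul_smul_comm, smul_smul, mul_assoc, mul_comm (p j (m - n))]

theorem aux_main {F A : Type*} [Field F] [Ring A] [Algebra F A]
    (m : ℕ) (u : ℕ → A) (p : ℕ → ℕ → F)
    (hpinv : ∀ i ∈ Finset.Icc 1 m, ∀ j ∈ Finset.Icc 1 m, p i j * p j i = 1)
    (hcomm : ∀ i ∈ Finset.Icc 1 m, ∀ j ∈ Finset.Icc 1 m, u i * u j = p i j • (u j * u i))
    (k : ℕ) (hk : k + 1 ≤ m) :
    nestedBracketR u p (m - k) k =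
      (∏ j ∈ Finset.Icc (m - k) (m - 1),
          (∏ l ∈ Finset.Icc (j + 1) m, p l j) *
            ((∏ l ∈ Finset.Icc (j + 1) m, p j l) ^ 3 - 1)) •
        ((List.range (k + 1)).map (fun i => u (m - i))).prod := by
  induction k with
  | zero =>
    have : Finset.Icc (m - 0) (m - 1) = ∅ := Finset.Icc_eq_empty (by omega)
    rw [this]
    simp [nestedBracketR]
  | succ k ih =>
    have ih := ih (by omega)
    rw [aux_prod _ (m - (k + 1)) (m - 1) (m - k) (by omega) (by omega)]
    rw [nestedBracketR]
    have e : m - (k + 1) + 1 = m - k := by omega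
    have e2 : m - (k + 1) + k + 1 = m := by omega
    have hj : m - (k + 1) ∈ Finset.Icc 1 m := by simp only [Finset.mem_Icc]; omega
    have hc := aux_comm m u p hcomm (m - (k + 1)) hj (k + 1) (by omega)
    rw [e] at hc
    rw [e2, e, ih, List.range_succ (n := k + 1), List.map_append, List.prod_append]
    simp only [List.map_cons, List.map_nil, List.prod_cons, List.prod_nil, mul_one]
    rw [mul_smul_comm, hc, smul_mul_assoc]
    have hPQ : (∏ l ∈ Finset.Icc (m - k) m, p (m - (k + 1)) l) *
        (∏ l ∈ Finset.Icc (m - k) m, p l (m - (k + 1))) = 1 := by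
      rw [← Finset.prod_mul_distrib]
      apply Finset.prod_eq_one
      intro l hl
      apply hpinv _ hj
      simp only [Finset.mem_Icc] at hl ⊢
      omega
    generalize (∏ l ∈ Finset.Icc (m - k) m, p (m - (k + 1)) l) = P at *
    generalize (∏ l ∈ Finset.Icc (m - k) m, p l (m - (k + 1))) = Q at *
    rw [smul_smul, smul_smul, smul_smul, ← sub_smul]
    congr 1
    generalize (∏ j ∈ Finset.Icc (m - k) (m - 1),
          (∏ l ∈ Finset.Icc (j + 1) m, p l j) *
            ((∏ l ∈ Finset.Icc (j + 1) m, p j l) ^ 3 - 1)) = C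
    linear_combination (-C * P ^ 2) * hPQ

theorem stmt0 {F A : Type*} [Field F] [CharZero F] [Ring A] [Algebra F A]
    (m : ℕ) (hm : 1 ≤ m) (u : ℕ → A) (p : ℕ → ℕ → F)
    (hp0 : ∀ i ∈ Finset.Icc 1 m, ∀ j ∈ Finset.Icc 1 m, p i j ≠ 0)
    (hpinv : ∀ i ∈ Finset.Icc 1 m, ∀ j ∈ Finset.Icc 1 m, p i j * p j i = 1)
    (hpeq : ∀ i ∈ Finset.Icc 1 m, ∀ j ∈ Finset.Icc 1 m, u i = u j → p i j = 1)
    (hcomm : ∀ i ∈ Finset.Icc 1 m, ∀ j ∈ Finset.Icc 1 m, u i * u j = p i j • (u j * u i)) :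
    nestedBracketR u p 1 (m - 1) =
      (∏ j ∈ Finset.Icc 1 (m - 1),
          (∏ l ∈ Finset.Icc (j + 1) m, p l j) *
            ((∏ l ∈ Finset.Icc (j + 1) m, p j l) ^ 3 - 1)) •
        ((List.range m).map (fun i => u (m - i))).prod := by
  have h := aux_main m u p hpinv hcomm (m - 1) (by omega)
  have e : m - (m - 1) = 1 := by omega
  have e2 : m - 1 + 1 = m := by omega
  rw [e, e2] at h
  exact h
end

section
/- With l_L as in the context, for every m ≥ 0: l_L(m) = p11^{m(m−1)/2} · ∑_{k=0}^{m} (−1)^k · C(m,k) · p12^{k} · p21^{m−k} · x^{m−k} y x^{k}, where C(m,k) is the ordinary binomial coefficient. -/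
/-- The iterated L-adjoint `l_x^m[y]_L`:
`l_L(0) = y` and `l_L(m) = p11^{m−1}·p21·(x·l_L(m−1)) − p11^{m−1}·p12·(l_L(m−1)·x)`. -/
noncomputable def lAdjL {F A : Type*} [Field F] [Ring A] [Algebra F A]
    (x y : A) (p11 p12 p21 : F) : ℕ → A
  | 0 => y
  | m + 1 => (p11 ^ m * p21) • (x * lAdjL x y p11 p12 p21 m)
      - (p11 ^ m * p12) • (lAdjL x y p11 p12 p21 m * x)

theorem stmt5 {F A : Type*} [Field F] [CharZero F] [Ring A] [Algebra F A]
    (x y : A) (p11 p12 p21 : F) (h11 : p11 ≠ 0) (h12 : p12 ≠ 0) (h21 : p21 ≠ 0) (m : ℕ) :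
    lAdjL x y p11 p12 p21 m =
      ∑ k ∈ Finset.range (m + 1),
        (p11 ^ (m * (m - 1) / 2) * (-1 : F) ^ k * (m.choose k : F) * p12 ^ k * p21 ^ (m - k)) •
          (x ^ (m - k) * y * x ^ k) := by
  set L : Module.End F A := p21 • LinearMap.mulLeft F x with hL
  set R : Module.End F A := (-p12) • LinearMap.mulRight F x with hR
  have hc : Commute R L := by
    have h0 : Commute (LinearMap.mulRight F x) (LinearMap.mulLeft F x) := by
      ext a
      simp [mul_assoc]
    exact (h0.smul_left _).smul_right _
  have hmain : ∀ n : ℕ, lAdjL x y p11 p12 p21 n = p11 ^ (n * (n - 1) / 2) • ((R + L) ^ n) y := by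
    intro n
    induction n with
    | zero => simp [lAdjL]
    | succ n ih =>
      have he : (n + 1) * (n + 1 - 1) / 2 = n + n * (n - 1) / 2 := by
        rw [← Finset.sum_range_id_mul_two (n + 1), ← Finset.sum_range_id_mul_two n,
          Nat.mul_div_cancel _ two_pos, Nat.mul_div_cancel _ two_pos, Finset.sum_range_succ,
          add_comm]
      rw [lAdjL, ih, he, pow_succ' (R + L), Module.End.mul_apply]
      generalize ((R + L) ^ n) y = z
      simp only [hL, hR, LinearMap.add_apply, LinearMap.smul_apply, LinearMap.mulLeft_apply,
        LinearMap.mulRight_apply, mul_smul_comm, smul_mul_assoc]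
      module
  rw [hmain, hc.add_pow, LinearMap.sum_apply, Finset.smul_sum]
  refine Finset.sum_congr rfl fun k _ => ?_
  have hn : ((m.choose k : ℕ) : Module.End F A) y = (m.choose k : F) • y := by
    rw [Module.End.natCast_apply, Nat.cast_smul_eq_nsmul]
  rw [Module.End.mul_apply, Module.End.mul_apply, hn, hL, hR, smul_pow, smul_pow,
    LinearMap.pow_mulLeft, LinearMap.pow_mulRight]
  simp only [LinearMap.smul_apply, LinearMap.mulLeft_apply,
        LinearMap.mulRight_apply, mul_smul_comm, smul_mul_assoc, smul_smul]
  congr 1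
  rw [neg_pow p12]
  ring
end

section
/- With l_R as in the context, for every m ≥ 0: l_R(m) = p11^{m(m−1)/2} · ∑_{k=0}^{m} (−1)^k · C(m,k) · p12^{m−k} · p21^{k} · x^{m−k} y x^{k}, where C(m,k) is the ordinary binomial coefficient. -/
/-- The iterated R-adjoint `l_x^m[y]_R`:
`l_R(0) = y` and `l_R(m) = p11^{m−1}·p12·(x·l_R(m−1)) − p11^{m−1}·p21·(l_R(m−1)·x)`. -/
noncomputable def lAdjR {F A : Type*} [Field F] [Ring A] [Algebra F A]
    (x y : A) (p11 p12 p21 : F) : ℕ → A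
  | 0 => y
  | m + 1 => (p11 ^ m * p12) • (x * lAdjR x y p11 p12 p21 m)
      - (p11 ^ m * p21) • (lAdjR x y p11 p12 p21 m * x)

theorem lAdjR_aux {F A : Type*} [Field F] [Ring A] [Algebra F A]
    (x y : A) (p11 p12 p21 : F) (m : ℕ) :
    lAdjR x y p11 p12 p21 m = p11 ^ (m * (m - 1) / 2) •
      (((-p21) • LinearMap.mulRight F x + p12 • LinearMap.mulLeft F x) ^ m) y := by
  induction m with
  | zero => simp [lAdjR]
  | succ m ih =>
    rw [lAdjR, ih, Nat.triangle_succ, pow_succ' _ m, Module.End.mul_apply]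
    simp only [LinearMap.add_apply, LinearMap.smul_apply, LinearMap.mulRight_apply,
      LinearMap.mulLeft_apply, mul_smul_comm, smul_mul_assoc]
    module

theorem stmt6 {F A : Type*} [Field F] [CharZero F] [Ring A] [Algebra F A]
    (x y : A) (p11 p12 p21 : F) (h11 : p11 ≠ 0) (h12 : p12 ≠ 0) (h21 : p21 ≠ 0) (m : ℕ) :
    lAdjR x y p11 p12 p21 m =
      ∑ k ∈ Finset.range (m + 1),
        (p11 ^ (m * (m - 1) / 2) * (-1 : F) ^ k * (m.choose k : F) * p12 ^ (m - k) * p21 ^ k) •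
          (x ^ (m - k) * y * x ^ k) := by
  have hc : Commute ((-p21) • LinearMap.mulRight F x) (p12 • LinearMap.mulLeft F x) :=
    ((LinearMap.commute_mulLeft_right (R := F) x x).symm.smul_left _).smul_right _
  rw [lAdjR_aux, hc.add_pow, LinearMap.sum_apply, Finset.smul_sum]
  refine Finset.sum_congr rfl fun k _ => ?_
  rw [← Nat.cast_comm, ← nsmul_eq_mul, smul_pow, smul_pow, LinearMap.pow_mulRight,
    LinearMap.pow_mulLeft]
  simp only [LinearMap.smul_apply, Module.End.mul_apply, LinearMap.mulRight_apply,
      LinearMap.mulLeft_apply, mul_smul_comm, smul_mul_assoc]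
  rw [← Nat.cast_smul_eq_nsmul F, neg_pow]
  module
end

section
/- With l as in the context, for every m ≥ 0: l(m) = ∑_{k=0}^{m} (−1)^k · p11^{k(k−1)/2} · p21^{k} · gbinom(m,k)_{p11} · x^{k} y x^{m−k}, where gbinom(m,k)_{p11} is the Gaussian binomial coefficient (an integer-coefficient polynomial in the variable a, evaluated at a = p11). -/
open Polynomial

/-- The quantum integer `(n)_a = 1 + a + a² + ⋯ + a^{n−1}` in `ℤ[a]`, with `(0)_a = 0`. -/
noncomputable def qInt (n : ℕ) : Polynomial ℤ := ∑ i ∈ Finset.range n, X ^ i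

/-- The quantum factorial `(n)_a! = ∏_{k=1}^{n} (k)_a` in `ℤ[a]`, with `(0)_a! = 1`. -/
noncomputable def qFact : ℕ → Polynomial ℤ
  | 0 => 1
  | n + 1 => qFact n * qInt (n + 1)

/-- The Gaussian binomial coefficient `gbinom(m,k)_a = (m)_a!/((k)_a!·(m−k)_a!) ∈ ℤ[a]`
(the division, by the monic polynomial `(k)_a!·(m−k)_a!`, is exact), and `0` for `k > m`. -/
noncomputable def gBinom (m k : ℕ) : Polynomial ℤ :=
  if k ≤ m then qFact m /ₘ (qFact k * qFact (m - k)) else 0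

/-- The iterated braided adjoint `l_x^m[y]`:
`l(0) = y` and `l(m) = l(m−1)·x − p11^{m−1}·p21·(x·l(m−1))`. -/
noncomputable def lAdjBr {F A : Type*} [Field F] [Ring A] [Algebra F A]
    (x y : A) (p11 p21 : F) : ℕ → A
  | 0 => y
  | m + 1 => lAdjBr x y p11 p21 m * x - (p11 ^ m * p21) • (x * lAdjBr x y p11 p21 m)

noncomputable def gRec : ℕ → ℕ → Polynomial ℤ
  | _, 0 => 1
  | 0, _ + 1 => 0
  | m + 1, k + 1 => gRec m (k + 1) + X ^ (m - k) * gRec m k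

theorem gRec_zero (m : ℕ) : gRec m 0 = 1 := by cases m <;> simp [gRec]

theorem gRec_of_lt (m k : ℕ) (h : m < k) : gRec m k = 0 := by
  induction m generalizing k with
  | zero => cases k with
    | zero => omega
    | succ k => simp [gRec]
  | succ m ih => cases k with
    | zero => omega
    | succ k => rw [gRec, ih _ (by omega), ih _ (by omega)]; simp

theorem gRec_self (m : ℕ) : gRec m m = 1 := by
  induction m with
  | zero => simp [gRec]
  | succ m ih => rw [gRec, ih, gRec_of_lt _ _ (by omega)]; simp

theorem qInt_add (a b : ℕ) : qInt (a + b) = qInt a + X ^ a * qInt b := by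
  simp only [qInt, Finset.sum_range_add, Finset.mul_sum, pow_add]

theorem gRec_mul (n a b : ℕ) (h : a + b = n) :
    gRec n a * (qFact a * qFact b) = qFact n := by
  induction n generalizing a b with
  | zero =>
    obtain rfl : a = 0 := by omega
    obtain rfl : b = 0 := by omega
    simp [gRec, qFact]
  | succ n ih =>
    rcases a with _ | a
    · obtain rfl : b = n + 1 := by omega
      simp [gRec_zero, qFact]
    · rcases b with _ | b
      · obtain rfl : a = n := by omega
        simp [gRec_self, qFact]
      · have h1 := ih (a + 1) b (by omega)
        have h2 := ih a (b + 1) (by omega)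
        have h3 := qInt_add (b + 1) (a + 1)
        have e : n - a = b + 1 := by omega
        have e2 : n + 1 = b + 1 + (a + 1) := by omega
        rw [gRec, e]
        have : qFact (n + 1) = qFact n * (qInt (b + 1) + X ^ (b + 1) * qInt (a + 1)) := by
          rw [← h3, ← e2, qFact]
        rw [this]
        simp only [qFact] at h1 h2 ⊢
        linear_combination qInt (b + 1) * h1 + X ^ (b + 1) * qInt (a + 1) * h2

theorem qFact_monic (n : ℕ) : (qFact n).Monic := by
  induction n with
  | zero => exact monic_one
  | succ n ih =>
    rw [qFact]
    exact ih.mul (Polynomial.Monic.geom_sum' monic_X (by simp) (by omega))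

theorem gBinom_eq (m k : ℕ) : gBinom m k = gRec m k := by
  unfold gBinom
  split_ifs with h
  · rw [← gRec_mul m k (m - k) (by omega), mul_comm,
      mul_divByMonic_cancel_left _ ((qFact_monic _).mul (qFact_monic _))]
  · rw [gRec_of_lt _ _ (by omega)]

theorem tri_succ (k : ℕ) : (k + 1) * (k + 1 - 1) / 2 = k * (k - 1) / 2 + k := by
  rw [← Finset.sum_range_id_mul_two, ← Finset.sum_range_id_mul_two, Finset.sum_range_succ]
  omega

theorem stmt7 {F A : Type*} [Field F] [CharZero F] [Ring A] [Algebra F A]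
    (x y : A) (p11 p12 p21 : F) (h11 : p11 ≠ 0) (h12 : p12 ≠ 0) (h21 : p21 ≠ 0) (m : ℕ) :
    lAdjBr x y p11 p21 m =
      ∑ k ∈ Finset.range (m + 1),
        ((-1 : F) ^ k * p11 ^ (k * (k - 1) / 2) * p21 ^ k *
            (Polynomial.aeval p11) (gBinom m k)) •
          (x ^ k * y * x ^ (m - k)) := by
  simp only [gBinom_eq]
  induction m with
  | zero => simp [lAdjBr, gRec]
  | succ m ih =>
    rw [lAdjBr, ih, Finset.sum_range_succ' _ (m + 1)]
    have hA : (∑ k ∈ Finset.range (m + 1),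
        ((-1 : F) ^ k * p11 ^ (k * (k - 1) / 2) * p21 ^ k *
            (Polynomial.aeval p11) (gRec m k)) • (x ^ k * y * x ^ (m - k))) * x =
        (∑ k ∈ Finset.range (m + 1),
        ((-1 : F) ^ (k + 1) * p11 ^ ((k + 1) * (k + 1 - 1) / 2) * p21 ^ (k + 1) *
            (Polynomial.aeval p11) (gRec m (k + 1))) • (x ^ (k + 1) * y * x ^ (m - k)))
          + y * x ^ (m + 1) := by
      rw [Finset.sum_range_succ', Finset.sum_range_succ _ m, gRec_of_lt m (m + 1) (by omega),
        add_mul, Finset.sum_mul]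
      simp only [map_zero, mul_zero, zero_smul, add_zero]
      congr 1
      · refine Finset.sum_congr rfl fun k hk => ?_
        have hk := Finset.mem_range.1 hk
        rw [smul_mul_assoc, mul_assoc _ _ x, ← pow_succ]
        congr 3
        omega
      · simp [gRec_zero, pow_succ, mul_assoc]
    rw [hA, Finset.mul_sum, Finset.smul_sum, add_sub_right_comm, ← Finset.sum_sub_distrib]
    congr 1
    · refine Finset.sum_congr rfl fun k hk => ?_
      have hk := Finset.mem_range.1 hk
      have e : m + 1 - (k + 1) = m - k := by omega
      have e2 : x * (x ^ k * y * x ^ (m - k)) = x ^ (k + 1) * y * x ^ (m - k) := by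
        simp only [pow_succ', mul_assoc]
      have e3 : p11 ^ m = p11 ^ (m - k) * p11 ^ k := by rw [← pow_add]; congr 1; omega
      rw [e, mul_smul_comm, e2, smul_smul, ← sub_smul, tri_succ, gRec, e3]
      congr 1
      simp only [map_add, map_mul, map_pow, aeval_X]
      ring
    · simp [gRec_zero]
end

section
/- With l_L as in the context, assume in addition that p21 = p12^{−1} with p12 ≠ 1, and that x·y = p12·y·x in A. Then for every m ≥ 0: l_L(m) = p11^{m(m−1)/2} · (1 − p12)^{m} · y·x^{m}. -/
theorem stmt8 {F A : Type*} [Field F] [CharZero F] [Ring A] [Algebra F A]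
    (x y : A) (p11 p12 p21 : F) (h11 : p11 ≠ 0) (h12 : p12 ≠ 0) (h21 : p21 ≠ 0)
    (hinv : p21 = p12⁻¹) (hne1 : p12 ≠ 1) (hxy : x * y = p12 • (y * x)) (m : ℕ) :
    lAdjL x y p11 p12 p21 m =
      (p11 ^ (m * (m - 1) / 2) * (1 - p12) ^ m) • (y * x ^ m) := by
  have hx : ∀ k : ℕ, x * (y * x ^ k) = p12 • (y * x ^ (k + 1)) := by
    intro k
    rw [← mul_assoc, hxy, smul_mul_assoc, mul_assoc, ← pow_succ']
  induction m with
  | zero => simp [lAdjL]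
  | succ k ih =>
    have he : (k + 1) * (k + 1 - 1) / 2 = k + k * (k - 1) / 2 := by
      rw [← Finset.sum_range_id, ← Finset.sum_range_id, Finset.sum_range_succ, add_comm]
    rw [lAdjL, ih, he, mul_smul_comm, hx, smul_mul_assoc, mul_assoc, ← pow_succ, smul_smul,
      smul_smul, smul_smul, ← sub_smul, hinv]
    congr 1
    field_simp
    ring
end

section
/- With l_L as in the context, let N ≥ 2 be an integer, assume p11 is a primitive N-th root of unity and that x^{N} = 0 in A. Then l_L(2N−2) = (−1)^{N−1} · p11^{(2N−2)(2N−3)/2} · C(2N−2, N−1) · (p12·p21)^{N−1} · x^{N−1} y x^{N−1}, where C(2N−2,N−1) is the ordinary binomial coefficient, and l_L(m) = 0 for every m ≥ 2N−1. -/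
theorem lAdjL_eq_sum {F A : Type*} [Field F] [Ring A] [Algebra F A]
    (x y : A) (p11 p12 p21 : F) (m : ℕ) :
    lAdjL x y p11 p12 p21 m = p11 ^ (m.choose 2) • ∑ k ∈ Finset.range (m + 1),
      (p21 ^ k * (-p12) ^ (m - k) * (m.choose k : F)) • (x ^ k * y * x ^ (m - k)) := by
  have h1 : lAdjL x y p11 p12 p21 m = p11 ^ (m.choose 2) •
      ((p21 • LinearMap.mulLeft F x + (-p12) • LinearMap.mulRight F x) ^ m) y := by
    induction m with
    | zero => simp [lAdjL]
    | succ m ih =>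
      rw [lAdjL, ih, pow_succ', Module.End.mul_apply, Nat.choose_succ_succ' m 1,
        Nat.choose_one_right, pow_add]
      simp only [LinearMap.add_apply, LinearMap.smul_apply, LinearMap.mulLeft_apply,
        LinearMap.mulRight_apply, mul_smul_comm, smul_mul_assoc, smul_add, smul_smul, neg_smul,
        smul_neg, sub_eq_add_neg]
      module
  have hc : Commute (p21 • LinearMap.mulLeft F x) ((-p12) • LinearMap.mulRight F x) :=
    ((LinearMap.commute_mulLeft_right (R := F) x x).smul_left _).smul_right _
  rw [h1, hc.add_pow, LinearMap.sum_apply]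
  congr 1
  refine Finset.sum_congr rfl fun k _ => ?_
  rw [smul_pow, smul_pow, LinearMap.pow_mulLeft, LinearMap.pow_mulRight,
    ← (Nat.cast_commute (m.choose k) _).eq, ← nsmul_eq_mul, ← Nat.cast_smul_eq_nsmul F]
  simp only [LinearMap.smul_apply, Module.End.mul_apply, LinearMap.mulLeft_apply,
    LinearMap.mulRight_apply, mul_smul_comm, smul_smul, mul_assoc]
  congr 1
  ring

theorem stmt10 {F A : Type*} [Field F] [CharZero F] [Ring A] [Algebra F A]
    (x y : A) (p11 p12 p21 : F) (h11 : p11 ≠ 0) (h12 : p12 ≠ 0) (h21 : p21 ≠ 0)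
    (N : ℕ) (hN : 2 ≤ N) (hprim : IsPrimitiveRoot p11 N) (hxN : x ^ N = 0) :
    lAdjL x y p11 p12 p21 (2 * N - 2) =
      ((-1 : F) ^ (N - 1) * p11 ^ ((2 * N - 2) * (2 * N - 3) / 2) *
          ((2 * N - 2).choose (N - 1) : F) * (p12 * p21) ^ (N - 1)) •
        (x ^ (N - 1) * y * x ^ (N - 1)) ∧
    ∀ m : ℕ, 2 * N - 1 ≤ m → lAdjL x y p11 p12 p21 m = 0 := by
  obtain ⟨n, rfl⟩ : ∃ n, N = n + 1 := ⟨N - 1, by omega⟩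
  have hz : ∀ k, n + 1 ≤ k → x ^ k = 0 := fun k hk => pow_eq_zero_of_le hk hxN
  refine ⟨?_, fun m hm => ?_⟩
  · rw [lAdjL_eq_sum, Finset.sum_eq_single n]
    · have e1 : 2 * (n + 1) - 2 = 2 * n := by omega
      have e2 : 2 * (n + 1) - 3 = 2 * n - 1 := by omega
      have e3 : 2 * n - n = n := by omega
      rw [e1, e2, e3, Nat.choose_two_right, smul_smul, Nat.add_sub_cancel]
      congr 1
      rw [neg_pow p12, mul_pow]
      ring
    · intro k _ hk
      rcases lt_or_gt_of_ne hk with h | h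
      · rw [hz (2 * (n + 1) - 2 - k) (by omega), mul_zero, smul_zero]
      · rw [hz k (by omega), zero_mul, zero_mul, smul_zero]
    · intro h
      exact absurd (Finset.mem_range.2 (by omega)) h
  · rw [lAdjL_eq_sum, Finset.sum_eq_zero, smul_zero]
    intro k _
    rcases Nat.lt_or_ge n k with h | h
    · rw [hz k h, zero_mul, zero_mul, smul_zero]
    · rw [hz (m - k) (by omega), mul_zero, smul_zero]
end

section
/- With l_R as in the context, let N ≥ 2 be an integer, assume p11 is a primitive N-th root of unity and that x^{N} = 0 in A. Then l_R(2N−2) = (−1)^{N−1} · p11^{(2N−2)(2N−3)/2} · C(2N−2, N−1) · (p12·p21)^{N−1} · x^{N−1} y x^{N−1}, where C(2N−2,N−1) is the ordinary binomial coefficient, and l_R(m) = 0 for every m ≥ 2N−1. -/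
theorem lAdjR_pow {F A : Type*} [Field F] [Ring A] [Algebra F A]
    (x y : A) (p q r : F) (m : ℕ) :
    lAdjR x y p q r m = p ^ (∑ i ∈ Finset.range m, i) •
      ((q • LinearMap.mulLeft F x + (-r) • LinearMap.mulRight F x) ^ m) y := by
  induction m with
  | zero => simp [lAdjR]
  | succ m ih =>
    rw [lAdjR, ih, pow_succ', Finset.sum_range_succ, Module.End.mul_apply]
    generalize ((q • LinearMap.mulLeft F x + (-r) • LinearMap.mulRight F x) ^ m) y = z
    simp only [LinearMap.add_apply, LinearMap.smul_apply, LinearMap.mulLeft_apply,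
      LinearMap.mulRight_apply, mul_smul_comm, smul_mul_assoc, smul_smul, smul_add, pow_add,
      neg_smul, mul_neg, smul_neg, ← sub_eq_add_neg]
    module

theorem lAdjR_sum {F A : Type*} [Field F] [Ring A] [Algebra F A]
    (x y : A) (p q r : F) (m : ℕ) :
    lAdjR x y p q r m = p ^ (m * (m - 1) / 2) • ∑ k ∈ Finset.range (m + 1),
      (q ^ k * (-r) ^ (m - k) * (m.choose k : F)) • (x ^ k * y * x ^ (m - k)) := by
  have hc : Commute (q • LinearMap.mulLeft F x) ((-r) • LinearMap.mulRight F x) :=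
    ((LinearMap.commute_mulLeft_right (R := F) x x).smul_left q).smul_right (-r)
  rw [lAdjR_pow, Finset.sum_range_id, hc.add_pow, LinearMap.sum_apply]
  congr 1
  refine Finset.sum_congr rfl fun k _ => ?_
  rw [(Nat.cast_commute _ _).eq.symm, ← nsmul_eq_mul, LinearMap.smul_apply, smul_pow, smul_pow,
    LinearMap.pow_mulLeft, LinearMap.pow_mulRight, Module.End.mul_apply]
  simp only [LinearMap.smul_apply, LinearMap.mulLeft_apply,
      LinearMap.mulRight_apply, mul_smul_comm, smul_smul, ← mul_assoc]
  rw [← Nat.cast_smul_eq_nsmul F, smul_smul]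
  congr 1
  ring

theorem stmt11 {F A : Type*} [Field F] [CharZero F] [Ring A] [Algebra F A]
    (x y : A) (p11 p12 p21 : F) (h11 : p11 ≠ 0) (h12 : p12 ≠ 0) (h21 : p21 ≠ 0)
    (N : ℕ) (hN : 2 ≤ N) (hprim : IsPrimitiveRoot p11 N) (hxN : x ^ N = 0) :
    lAdjR x y p11 p12 p21 (2 * N - 2) =
      ((-1 : F) ^ (N - 1) * p11 ^ ((2 * N - 2) * (2 * N - 3) / 2) *
          ((2 * N - 2).choose (N - 1) : F) * (p12 * p21) ^ (N - 1)) •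
        (x ^ (N - 1) * y * x ^ (N - 1)) ∧
    ∀ m : ℕ, 2 * N - 1 ≤ m → lAdjR x y p11 p12 p21 m = 0 := by
  have hz : ∀ k, N ≤ k → x ^ k = 0 := fun k hk => pow_eq_zero_of_le hk hxN
  constructor
  · rw [lAdjR_sum, Finset.sum_eq_single (N - 1)]
    · have e1 : 2 * N - 2 - (N - 1) = N - 1 := by omega
      have e2 : 2 * N - 2 - 1 = 2 * N - 3 := by omega
      rw [e1, e2, smul_smul]
      congr 1
      rw [neg_pow p21, mul_pow]
      ring
    · intro k _ hk
      rcases lt_or_ge k N with h | h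
      · rw [hz (2 * N - 2 - k) (by omega)]; simp
      · rw [hz k h]; simp
    · intro h
      exact absurd (Finset.mem_range.2 (by omega)) h
  · intro m hm
    rw [lAdjR_sum, Finset.sum_eq_zero, smul_zero]
    intro k _
    rcases lt_or_ge k N with h | h
    · rw [hz (m - k) (by omega)]; simp
    · rw [hz k h]; simp
end

section
/- In the algebra A of the context, define u_0 = x1 and, for i ≥ 1, u_i = [[u_{i−1}, x2]_R, x1]_R (so u_i = (r_{x1} r_{x2})^i [x1]_R, where r_w[v]_R = [v,w]_R and the brackets are the graded R-brackets of the context). Likewise define w_0 = x2 and w_i = [[w_{i−1}, x1]_R, x2]_R = (r_{x2} r_{x1})^i [x2]_R. Then for all i ≥ 0: u_i = (−2)^{i} · (p12·p21)^{i(i+1)/2} · (x1 x2)^{i} x1 and w_i = (−2)^{i} · (p12·p21)^{i(i+1)/2} · x2 (x1 x2)^{i}. -/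
/-- The relations `x1² = 0`, `x2² = 0` in the free algebra `F⟨x1,x2⟩`. -/
inductive sqRel (F : Type*) [Field F] :
    FreeAlgebra F (Fin 2) → FreeAlgebra F (Fin 2) → Prop
  | sq1 : sqRel F (FreeAlgebra.ι F 0 * FreeAlgebra.ι F 0) 0
  | sq2 : sqRel F (FreeAlgebra.ι F 1 * FreeAlgebra.ι F 1) 0

/-- The algebra `A = F⟨x1,x2⟩/(x1², x2²)`. -/
abbrev QAlg (F : Type*) [Field F] := RingQuot (sqRel F)

/-- The generator `x1` of `A`. -/
noncomputable def X1 (F : Type*) [Field F] : QAlg F :=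
  RingQuot.mkAlgHom F (sqRel F) (FreeAlgebra.ι F 0)

/-- The generator `x2` of `A`. -/
noncomputable def X2 (F : Type*) [Field F] : QAlg F :=
  RingQuot.mkAlgHom F (sqRel F) (FreeAlgebra.ι F 1)

/-- The bicharacter `p((a,b),(c,d)) = (−1)^{ac}·p12^{ad}·p21^{bc}·(−1)^{bd}` on `ℤ²`. -/
noncomputable def bichar {F : Type*} [Field F] (p12 p21 : F) (d e : ℤ × ℤ) : F :=
  (-1 : F) ^ (d.1 * e.1) * p12 ^ (d.1 * e.2) * p21 ^ (d.2 * e.1) * (-1 : F) ^ (d.2 * e.2)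

/-- The graded R-bracket on pairs (degree, element): `[u,v]_R = p_{u,v}·uv − p_{v,u}·vu`. -/
noncomputable def brR {F : Type*} [Field F] (p12 p21 : F)
    (u v : (ℤ × ℤ) × QAlg F) : (ℤ × ℤ) × QAlg F :=
  (u.1 + v.1, bichar p12 p21 u.1 v.1 • (u.2 * v.2) - bichar p12 p21 v.1 u.1 • (v.2 * u.2))

/-- The graded L-bracket on pairs (degree, element): `[u,v]_L = p_{v,u}·uv − p_{u,v}·vu`. -/
noncomputable def brL {F : Type*} [Field F] (p12 p21 : F)
    (u v : (ℤ × ℤ) × QAlg F) : (ℤ × ℤ) × QAlg F :=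
  (u.1 + v.1, bichar p12 p21 v.1 u.1 • (u.2 * v.2) - bichar p12 p21 u.1 v.1 • (v.2 * u.2))

/-- `x1` together with its degree `(1,0)`. -/
noncomputable def x1P (F : Type*) [Field F] : (ℤ × ℤ) × QAlg F := ((1, 0), X1 F)

/-- `x2` together with its degree `(0,1)`. -/
noncomputable def x2P (F : Type*) [Field F] : (ℤ × ℤ) × QAlg F := ((0, 1), X2 F)

/-- `u_i = (r_{x1} r_{x2})^i [x1]_R`: `u_0 = x1`, `u_{i+1} = [[u_i, x2]_R, x1]_R`
(computed together with its degree). -/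
noncomputable def uSeqR {F : Type*} [Field F] (p12 p21 : F) : ℕ → (ℤ × ℤ) × QAlg F
  | 0 => x1P F
  | i + 1 => brR p12 p21 (brR p12 p21 (uSeqR p12 p21 i) (x2P F)) (x1P F)

/-- `w_i = (r_{x2} r_{x1})^i [x2]_R`: `w_0 = x2`, `w_{i+1} = [[w_i, x1]_R, x2]_R`
(computed together with its degree). -/
noncomputable def wSeqR {F : Type*} [Field F] (p12 p21 : F) : ℕ → (ℤ × ℤ) × QAlg F
  | 0 => x2P F
  | i + 1 => brR p12 p21 (brR p12 p21 (wSeqR p12 p21 i) (x1P F)) (x2P F)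

theorem X1_sq (F : Type*) [Field F] : X1 F * X1 F = 0 := by
  have h := RingQuot.mkAlgHom_rel F (sqRel.sq1 (F := F))
  simpa [X1] using h

theorem X2_sq (F : Type*) [Field F] : X2 F * X2 F = 0 := by
  have h := RingQuot.mkAlgHom_rel F (sqRel.sq2 (F := F))
  simpa [X2] using h

theorem step_aux {F R : Type*} [Field F] [Ring R] [Algebra F R] (m X Y n : R)
    (c c1 c2 c3 c4 d : F) (h1 : m * X = 0) (h2 : X * m = 0)
    (h3 : m * (Y * X) = n) (h4 : X * (Y * m) = n) (hd : c1 * c2 * c + c4 * c3 * c = d) :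
    c1 • ((c2 • ((c • m) * Y) - c3 • (Y * (c • m))) * X)
      - c4 • (X * (c2 • ((c • m) * Y) - c3 • (Y * (c • m)))) = d • n := by
  have h5 : X * (m * Y) = 0 := by rw [← mul_assoc, h2, zero_mul]
  subst hd
  simp only [sub_mul, mul_sub, smul_mul_assoc, mul_smul_comm, mul_assoc, h1, h3, h4, h5,
    mul_zero, smul_zero, sub_zero, zero_sub, smul_neg, sub_neg_eq_add, smul_smul, add_smul]

theorem tri_aux (i : ℕ) : (i + 1) * (i + 1 + 1) / 2 = i * (i + 1) / 2 + (i + 1) := by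
  have : (i + 1) * (i + 1 + 1) = i * (i + 1) + (i + 1) * 2 := by ring
  rw [this, Nat.add_mul_div_right _ _ (by norm_num)]

theorem uDeg {F : Type*} [Field F] (p12 p21 : F) (i : ℕ) :
    (uSeqR p12 p21 i).1 = ((i : ℤ) + 1, (i : ℤ)) := by
  induction i with
  | zero => simp [uSeqR, x1P]
  | succ k ih => simp [uSeqR, brR, x1P, x2P, ih]

theorem wDeg {F : Type*} [Field F] (p12 p21 : F) (i : ℕ) :
    (wSeqR p12 p21 i).1 = ((i : ℤ), (i : ℤ) + 1) := by
  induction i with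
  | zero => simp [wSeqR, x2P]
  | succ k ih => simp [wSeqR, brR, x1P, x2P, ih]

theorem zp {F : Type*} [Field F] (a : F) (k : ℕ) : a ^ ((k : ℤ) + 1) = a ^ (k + 1) := by
  exact_mod_cast zpow_natCast a (k + 1)

theorem sgn_aux {F : Type*} [Field F] (k : ℕ) : ((-1 : F) ^ k) * (-1) ^ k = 1 := by
  rw [← mul_pow]; simp

theorem stmt12 {F : Type*} [Field F] [CharZero F] (p12 p21 : F)
    (h12 : p12 ≠ 0) (h21 : p21 ≠ 0) (i : ℕ) :
    (uSeqR p12 p21 i).2 =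
      ((-2 : F) ^ i * (p12 * p21) ^ (i * (i + 1) / 2)) • ((X1 F * X2 F) ^ i * X1 F) ∧
    (wSeqR p12 p21 i).2 =
      ((-2 : F) ^ i * (p12 * p21) ^ (i * (i + 1) / 2)) • (X2 F * (X1 F * X2 F) ^ i) := by
  induction i with
  | zero => simp [uSeqR, wSeqR, x1P, x2P]
  | succ k ih =>
    obtain ⟨ihu, ihw⟩ := ih
    have e1 := X1_sq F
    have e2 := X2_sq F
    have hs := sgn_aux (F := F) k
    have hc : X2 F * (X1 F * X2 F) ^ k = (X2 F * X1 F) ^ k * X2 F := by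
      clear ihu ihw hs
      induction k with
      | zero => simp
      | succ j ih => rw [pow_succ, ← mul_assoc, ih, pow_succ]; simp only [mul_assoc]
    have hc' : (X1 F * X2 F) ^ k * X1 F = X1 F * (X2 F * X1 F) ^ k := by
      clear ihu ihw hs hc
      induction k with
      | zero => simp
      | succ j ih => rw [pow_succ', mul_assoc, ih, pow_succ']; simp only [mul_assoc]
    constructor
    · simp only [uSeqR, brR, uDeg, ihu, x1P, x2P]
      apply step_aux ((X1 F * X2 F) ^ k * X1 F) (X1 F) (X2 F)
      · rw [mul_assoc, e1, mul_zero]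
      · rw [hc', ← mul_assoc, e1, zero_mul]
      · rw [pow_succ]; simp only [mul_assoc]
      · rw [pow_succ']; simp only [mul_assoc]
      · rw [tri_aux]
        simp only [bichar, Prod.mk_add_mk, mul_one, mul_zero, one_mul, zero_mul, zpow_zero,
          add_zero, zero_add, zp, zpow_natCast]
        rw [pow_add _ _ (k + 1), pow_succ (-2 : F), mul_pow _ _ (k + 1), pow_succ (-1 : F)]
        linear_combination (-2 * p12 ^ (k + 1) * p21 ^ (k + 1) * (-2) ^ k * (p12 * p21) ^ (k * (k + 1) / 2)) * hs
    · simp only [wSeqR, brR, wDeg, ihw, x1P, x2P]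
      apply step_aux (X2 F * (X1 F * X2 F) ^ k) (X2 F) (X1 F)
      · rw [hc, mul_assoc, e2, mul_zero]
      · rw [← mul_assoc, e2, zero_mul]
      · rw [pow_succ]; simp only [mul_assoc]
      · rw [pow_succ']; simp only [mul_assoc]
      · rw [tri_aux]
        simp only [bichar, Prod.mk_add_mk, mul_one, mul_zero, one_mul, zero_mul, zpow_zero,
          add_zero, zero_add, zp, zpow_natCast]
        rw [pow_add _ _ (k + 1), pow_succ (-2 : F), mul_pow _ _ (k + 1), pow_succ (-1 : F)]
        linear_combination (-2 * p12 ^ (k + 1) * p21 ^ (k + 1) * (-2) ^ k * (p12 * p21) ^ (k * (k + 1) / 2)) * hs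
end

section
/- In the algebra A of the context, define W_1 = [x1, x2]_L and, for k ≥ 2, W_k = [[W_{k−1}, x1]_L, x2]_L (the left-normed alternating bracket [[…[[x1,x2]_L, x1]_L, x2]_L …]_L with 2k−1 brackets, using the graded L-bracket of the context). Then for all k ≥ 1: W_k = 2^{k−1} · (p12·p21)^{k(k−1)/2} · (p21^{k}·(x1 x2)^{k} − p12^{k}·(x2 x1)^{k}). -/
/-- `W_{k+1}` (indexed from `0`): `altL 0 = [x1,x2]_L` and
`altL k = [[altL (k−1), x1]_L, x2]_L`, i.e. the left-normed alternating bracket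
`[[…[[x1,x2]_L, x1]_L, x2]_L …]_L` with `2k+1` brackets (computed with its degree). -/
noncomputable def altL {F : Type*} [Field F] (p12 p21 : F) : ℕ → (ℤ × ℤ) × QAlg F
  | 0 => brL p12 p21 (x1P F) (x2P F)
  | k + 1 => brL p12 p21 (brL p12 p21 (altL p12 p21 k) (x1P F)) (x2P F)

theorem altL_fst {F : Type*} [Field F] (p12 p21 : F) (n : ℕ) :
    (altL p12 p21 n).1 = (((n + 1 : ℕ) : ℤ), ((n + 1 : ℕ) : ℤ)) := by
  induction n with
  | zero => simp [altL, brL, x1P, x2P]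
  | succ n ih => simp [altL, brL, x1P, x2P, ih]

theorem altL_snd {F : Type*} [Field F] (p12 p21 : F) (n : ℕ) :
    (altL p12 p21 n).2 =
      ((2 : F) ^ n * (p12 * p21) ^ ((n + 1) * n / 2)) •
        (p21 ^ (n + 1) • ((X1 F * X2 F) ^ (n + 1)) - p12 ^ (n + 1) • ((X2 F * X1 F) ^ (n + 1))) := by
  induction n with
  | zero => simp [altL, brL, x1P, x2P, bichar]
  | succ n ih =>
    have hd := altL_fst p12 p21 n
    have e : (n + 1 + 1) * (n + 1) / 2 = (n + 1) * n / 2 + (n + 1) := by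
      rw [show (n + 1 + 1) * (n + 1) = (n + 1) * n + (n + 1) * 2 by ring,
        Nat.add_mul_div_right _ _ (by norm_num)]
    have hb : (X2 F * X1 F) ^ (n + 1) * X1 F = 0 := by
      rw [pow_succ, mul_assoc, mul_assoc, X1_sq]; simp
    have ha : X1 F * (X1 F * X2 F) ^ (n + 1) = 0 := by
      rw [pow_succ', ← mul_assoc, ← mul_assoc, X1_sq]; simp
    have hc : X1 F * (X2 F * X1 F) ^ (n + 1) = (X1 F * X2 F) ^ (n + 1) * X1 F := by
      have : SemiconjBy (X1 F) (X2 F * X1 F) (X1 F * X2 F) := by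
        simp [SemiconjBy, mul_assoc]
      exact this.pow_right (n + 1)
    have hs : ((-1 : F) ^ (n + 1)) * (-1) ^ (n + 1) = 1 := by
      rw [← mul_pow]; simp
    obtain ⟨c, hcdef⟩ : ∃ c, c = (2 : F) ^ n * (p12 * p21) ^ ((n + 1) * n / 2) := ⟨_, rfl⟩
    rw [← hcdef] at ih
    have hV : (brL p12 p21 (altL p12 p21 n) (x1P F)).2 =
        ((-1) ^ (n + 1) * c * (p12 * p21) ^ (n + 1) * 2) • ((X1 F * X2 F) ^ (n + 1) * X1 F) := by
      simp only [brL, x1P, bichar, hd, ih, one_mul, zero_mul, mul_one, mul_zero, zpow_zero,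
        zpow_natCast, smul_mul_assoc, mul_smul_comm, sub_mul, mul_sub, ha, hb, hc, smul_zero,
        sub_zero, zero_sub]
      module
    have hVd : (brL p12 p21 (altL p12 p21 n) (x1P F)).1 =
        (((n + 2 : ℕ) : ℤ), ((n + 1 : ℕ) : ℤ)) := by
      simp only [brL, hd, x1P]; ext <;> simp; ring
    have hx : X2 F * ((X1 F * X2 F) ^ (n + 1) * X1 F) = (X2 F * X1 F) ^ (n + 2) := by
      rw [← hc, ← mul_assoc, ← pow_succ']
    have hy : (X1 F * X2 F) ^ (n + 1) * X1 F * X2 F = (X1 F * X2 F) ^ (n + 2) := by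
      rw [mul_assoc, ← pow_succ]
    rw [altL, brL, hV, hVd, e]
    simp only [x2P, bichar, one_mul, zero_mul, mul_one, mul_zero, zpow_zero,
        zpow_natCast, smul_mul_assoc, mul_smul_comm, hx, hy, smul_sub, smul_smul]
    have e1 : p21 ^ (n + 2) * (-1) ^ (n + 1) * ((-1) ^ (n + 1) * c * (p12 * p21) ^ (n + 1) * 2)
        = 2 ^ (n + 1) * (p12 * p21) ^ ((n + 1) * n / 2 + (n + 1)) * p21 ^ (n + 1 + 1) := by
      rw [pow_add (p12 * p21), hcdef]
      linear_combination (p21 ^ (n + 2) * (2 ^ n * (p12 * p21) ^ ((n + 1) * n / 2)) * (p12 * p21) ^ (n + 1) * 2) * hs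
    have e2 : p12 ^ (n + 2) * (-1) ^ (n + 1) * ((-1) ^ (n + 1) * c * (p12 * p21) ^ (n + 1) * 2)
        = 2 ^ (n + 1) * (p12 * p21) ^ ((n + 1) * n / 2 + (n + 1)) * p12 ^ (n + 1 + 1) := by
      rw [pow_add (p12 * p21), hcdef]
      linear_combination (p12 ^ (n + 2) * (2 ^ n * (p12 * p21) ^ ((n + 1) * n / 2)) * (p12 * p21) ^ (n + 1) * 2) * hs
    rw [e1, e2]

theorem stmt15 {F : Type*} [Field F] [CharZero F] (p12 p21 : F)
    (h12 : p12 ≠ 0) (h21 : p21 ≠ 0) (k : ℕ) (hk : 1 ≤ k) :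
    (altL p12 p21 (k - 1)).2 =
      ((2 : F) ^ (k - 1) * (p12 * p21) ^ (k * (k - 1) / 2)) •
        (p21 ^ k • ((X1 F * X2 F) ^ k) - p12 ^ k • ((X2 F * X1 F) ^ k)) := by
  obtain ⟨n, rfl⟩ : ∃ n, k = n + 1 := ⟨k - 1, by omega⟩
  exact altL_snd p12 p21 n
end

section
/- In the algebra A of the context, let k > 0, let x_{i_1}, …, x_{i_N} be any sequence of letters from {x1, x2}, and let σ be any full parenthesization (planar binary tree evaluation) of this sequence using the graded R-bracket [·,·]_R of the context. If N = 2k, then there exists α ∈ F such that σ(x_{i_1},…,x_{i_{2k}}) = α·(p12^{k}·(x1 x2)^{k} − p21^{k}·(x2 x1)^{k}). If N = 2k+1, then there exists β ∈ F such that σ(x_{i_1},…,x_{i_{2k+1}}) = β·(x1 x2)^{k} x1 or σ(x_{i_1},…,x_{i_{2k+1}}) = β·x2 (x1 x2)^{k}. -/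
/-- A planar binary tree whose leaves are labelled by letters from `{x1, x2}`
(a letter being recorded as an index in `Fin 2`). -/
inductive BTree : Type where
  | leaf : Fin 2 → BTree
  | node : BTree → BTree → BTree

/-- The list of leaf labels of a tree, read from left to right. -/
def BTree.leaves : BTree → List (Fin 2)
  | .leaf i => [i]
  | .node s t => s.leaves ++ t.leaves

/-- The generator (with its degree) corresponding to a letter. -/
noncomputable def genP (F : Type*) [Field F] (i : Fin 2) : (ℤ × ℤ) × QAlg F :=
  if i = 0 then x1P F else x2P F

/-- Evaluation of a full parenthesization (planar binary tree) using the graded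
R-bracket, computed together with its degree. -/
noncomputable def BTree.evalR {F : Type*} [Field F] (p12 p21 : F) :
    BTree → (ℤ × ℤ) × QAlg F
  | .leaf i => genP F i
  | .node s t => brR p12 p21 (s.evalR p12 p21) (t.evalR p12 p21)

section Helpers

variable {F : Type*} [Field F]

lemma qneg (c : F) (v : QAlg F) : -(c • v) = (-c) • v := by
  rw [neg_eq_iff_add_eq_zero, ← add_smul, add_neg_cancel, zero_smul]

lemma X1sq : X1 F * X1 F = 0 := by
  have h := RingQuot.mkAlgHom_rel F (sqRel.sq1 (F := F))
  simpa [X1] using h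

lemma X2sq : X2 F * X2 F = 0 := by
  have h := RingQuot.mkAlgHom_rel F (sqRel.sq2 (F := F))
  simpa [X2] using h

lemma x2a (k : ℕ) : X2 F * (X1 F * X2 F) ^ k = (X2 F * X1 F) ^ k * X2 F :=
  SemiconjBy.pow_right (a := X2 F) (x := X1 F * X2 F) (y := X2 F * X1 F)
    (by simp [SemiconjBy, mul_assoc]) k

lemma x1b (k : ℕ) : X1 F * (X2 F * X1 F) ^ k = (X1 F * X2 F) ^ k * X1 F :=
  SemiconjBy.pow_right (a := X1 F) (x := X2 F * X1 F) (y := X1 F * X2 F)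
    (by simp [SemiconjBy, mul_assoc]) k

lemma x1a (k : ℕ) : X1 F * (X1 F * X2 F) ^ (k + 1) = 0 := by
  rw [pow_succ', ← mul_assoc, ← mul_assoc, X1sq]; simp

lemma x2b (k : ℕ) : X2 F * (X2 F * X1 F) ^ (k + 1) = 0 := by
  rw [pow_succ', ← mul_assoc, ← mul_assoc, X2sq]; simp

lemma bx1 (k : ℕ) : (X2 F * X1 F) ^ (k + 1) * X1 F = 0 := by
  rw [pow_succ, mul_assoc, mul_assoc, X1sq]; simp

lemma ax2 (k : ℕ) : (X1 F * X2 F) ^ (k + 1) * X2 F = 0 := by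
  rw [pow_succ, mul_assoc, mul_assoc, X2sq]; simp

lemma ab0 (k l : ℕ) : (X1 F * X2 F) ^ (k + 1) * (X2 F * X1 F) ^ (l + 1) = 0 := by
  rw [pow_succ' _ l, ← mul_assoc, ← mul_assoc, ax2]; simp

lemma ba0 (k l : ℕ) : (X2 F * X1 F) ^ (k + 1) * (X1 F * X2 F) ^ (l + 1) = 0 := by
  rw [pow_succ' _ l, ← mul_assoc, ← mul_assoc, bx1]; simp

/-- The even basis element. -/
noncomputable def EE (p q : F) (k : ℕ) : QAlg F :=
  p ^ k • ((X1 F * X2 F) ^ k) - q ^ k • ((X2 F * X1 F) ^ k)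

/-- First odd element. -/
noncomputable def O1 (F : Type*) [Field F] (k : ℕ) : QAlg F := (X1 F * X2 F) ^ k * X1 F

/-- Second odd element. -/
noncomputable def O2 (F : Type*) [Field F] (k : ℕ) : QAlg F := X2 F * (X1 F * X2 F) ^ k

lemma EE_comm (p q : F) (k l : ℕ) :
    EE p q (k+1) * EE p q (l+1) = EE p q (l+1) * EE p q (k+1) := by
  simp only [EE, sub_mul, mul_sub, smul_mul_smul_comm, ab0, ba0, ← pow_add, add_comm (l+1)]
  simp

lemma EE_O1 (p q : F) (k l : ℕ) : EE p q (k+1) * O1 F l = p^(k+1) • O1 F (k+1+l) := by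
  have h : (X2 F * X1 F) ^ (k+1) * ((X1 F * X2 F) ^ l * X1 F) = 0 := by
    rw [← x1b, ← mul_assoc, bx1, zero_mul]
  simp only [EE, O1, sub_mul, smul_mul_assoc, h]
  rw [pow_add _ (k+1) l, mul_assoc]; simp

lemma O1_EE (p q : F) (k l : ℕ) : O1 F l * EE p q (k+1) = (-q^(k+1)) • O1 F (k+1+l) := by
  simp only [EE, O1, mul_sub, mul_smul_comm, mul_assoc, x1a]
  rw [x1b, ← mul_assoc, ← pow_add, add_comm l, mul_zero, smul_zero, zero_sub]; exact qneg _ _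

lemma EE_O2 (p q : F) (k l : ℕ) : EE p q (k+1) * O2 F l = (-q^(k+1)) • O2 F (k+1+l) := by
  simp only [EE, O2, sub_mul, smul_mul_assoc, ← mul_assoc, ax2]
  rw [← x2a, mul_assoc, ← pow_add, zero_mul, smul_zero, zero_sub]; exact qneg _ _

lemma O2_EE (p q : F) (k l : ℕ) : O2 F l * EE p q (k+1) = p^(k+1) • O2 F (k+1+l) := by
  have h : (X2 F * (X1 F * X2 F) ^ l) * (X2 F * X1 F) ^ (k+1) = 0 := by
    rw [x2a, mul_assoc, x2b, mul_zero]
  simp only [EE, O2, mul_sub, mul_smul_comm, h]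
  rw [mul_assoc, ← pow_add, add_comm l]; simp

lemma O1_O1 (k l : ℕ) : O1 F k * O1 F l = 0 := by
  simp only [O1]
  rw [← x1b l, mul_assoc, ← mul_assoc (X1 F) (X1 F), X1sq]; simp

lemma O2_O2 (k l : ℕ) : O2 F k * O2 F l = 0 := by
  simp only [O2]
  rw [x2a k, mul_assoc, ← mul_assoc (X2 F) (X2 F), X2sq]; simp

lemma O1_O2 (k l : ℕ) : O1 F k * O2 F l = (X1 F * X2 F) ^ (k+l+1) := by
  simp only [O1, O2]
  rw [show k+l+1 = k+(1+l) by ring, pow_add, pow_add, pow_one]; simp only [mul_assoc]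

lemma O2_O1 (k l : ℕ) : O2 F l * O1 F k = (X2 F * X1 F) ^ (k+l+1) := by
  simp only [O1, O2]
  rw [x2a, ← x1b, show k+l+1 = l+(1+k) by ring, pow_add, pow_add, pow_one]; simp only [mul_assoc]

/-- The invariant. -/
def Good (p q : F) (n : ℕ) (d : ℤ × ℤ) (v : QAlg F) : Prop :=
  v = 0 ∨
  (∃ (k : ℕ) (c : F), n = 2*(k+1) ∧ d = ((k:ℤ)+1, (k:ℤ)+1) ∧ v = c • EE p q (k+1)) ∨
  (∃ (k : ℕ) (c : F), n = 2*k+1 ∧ d = ((k:ℤ)+1, (k:ℤ)) ∧ v = c • O1 F k) ∨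
  (∃ (k : ℕ) (c : F), n = 2*k+1 ∧ d = ((k:ℤ), (k:ℤ)+1) ∧ v = c • O2 F k)

lemma Good.neg {p q : F} {n : ℕ} {d : ℤ × ℤ} {v : QAlg F} (h : Good p q n d v) :
    Good p q n d (-v) := by
  rcases h with h | ⟨k, c, h1, h2, h3⟩ | ⟨k, c, h1, h2, h3⟩ | ⟨k, c, h1, h2, h3⟩
  · left; simp [h]
  · right; left; exact ⟨k, -c, h1, h2, by rw [h3]; exact qneg _ _⟩
  · right; right; left; exact ⟨k, -c, h1, h2, by rw [h3]; exact qneg _ _⟩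
  · right; right; right; exact ⟨k, -c, h1, h2, by rw [h3]; exact qneg _ _⟩

/-- Bracket preserves the invariant. -/
def GB (p q : F) (n m : ℕ) (d e : ℤ × ℤ) (u v : QAlg F) : Prop :=
  Good p q (n+m) (d+e) (bichar p q d e • (u*v) - bichar p q e d • (v*u))

lemma GB.symm {p q : F} {n m : ℕ} {d e : ℤ × ℤ} {u v : QAlg F} (h : GB p q n m d e u v) :
    GB p q m n e d v u := by
  have := Good.neg h
  rw [neg_sub, add_comm n, add_comm d] at this
  exact this

lemma gb_E_O1 (p q c c' : F) (k l : ℕ) : GB p q (2*(k+1)) (2*l+1) ((k:ℤ)+1, (k:ℤ)+1)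
    ((l:ℤ)+1, (l:ℤ)) (c • EE p q (k+1)) (c' • O1 F l) := by
  right; right; left
  simp only [smul_mul_smul_comm, EE_O1, O1_EE, smul_smul, ← sub_smul]
  exact ⟨k+1+l, _, by ring, by ext <;> simp <;> ring, rfl⟩

lemma gb_E_O2 (p q c c' : F) (k l : ℕ) : GB p q (2*(k+1)) (2*l+1) ((k:ℤ)+1, (k:ℤ)+1)
    ((l:ℤ), (l:ℤ)+1) (c • EE p q (k+1)) (c' • O2 F l) := by
  right; right; right
  simp only [smul_mul_smul_comm, EE_O2, O2_EE, smul_smul, ← sub_smul]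
  exact ⟨k+1+l, _, by ring, by ext <;> simp <;> ring, rfl⟩

lemma gb_O1_O2 (p q c c' : F) (k l : ℕ) :
    GB p q (2*k+1) (2*l+1) ((k:ℤ)+1, (k:ℤ))
    ((l:ℤ), (l:ℤ)+1) (c • O1 F k) (c' • O2 F l) := by
  right; left
  refine ⟨k+l, c * c' * ((-1)^((k+1)*l) * (-1)^(k*(l+1)) * p^(k*l) * q^(k*l)), by ring,
    by ext <;> simp <;> ring, ?_⟩
  have e1 : bichar p q ((k:ℤ)+1, (k:ℤ)) ((l:ℤ), (l:ℤ)+1) =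
      ((-1)^((k+1)*l) * (-1)^(k*(l+1)) * p^(k*l) * q^(k*l)) * p^(k+l+1) := by
    simp only [bichar]
    generalize (-1 : F) = z
    norm_cast
    ring
  have e2 : bichar p q ((l:ℤ), (l:ℤ)+1) ((k:ℤ)+1, (k:ℤ)) =
      ((-1)^((k+1)*l) * (-1)^(k*(l+1)) * p^(k*l) * q^(k*l)) * q^(k+l+1) := by
    simp only [bichar]
    generalize (-1 : F) = z
    norm_cast
    ring
  rw [e1, e2]
  simp only [smul_mul_smul_comm, O1_O2, O2_O1, EE, smul_sub, smul_smul]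
  congr 2 <;> ring

lemma good_bracket {p q : F} {n m : ℕ} {d e : ℤ × ℤ} {u v : QAlg F}
    (hu : Good p q n d u) (hv : Good p q m e v) : GB p q n m d e u v := by
  rcases hu with rfl | ⟨k, c, rfl, rfl, rfl⟩ | ⟨k, c, rfl, rfl, rfl⟩ | ⟨k, c, rfl, rfl, rfl⟩
  · left; simp
  all_goals
    rcases hv with rfl | ⟨l, c', rfl, rfl, rfl⟩ | ⟨l, c', rfl, rfl, rfl⟩ | ⟨l, c', rfl, rfl, rfl⟩
    · left; simp
  · left
    simp only [smul_mul_smul_comm, EE_comm p q l k, mul_comm c' c, ← sub_smul, bichar]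
    rw [sub_eq_zero]
    congr 1
    simp only [mul_comm]
  · exact gb_E_O1 ..
  · exact gb_E_O2 ..
  · exact (gb_E_O1 ..).symm
  · left; simp [smul_mul_smul_comm, O1_O1]
  · exact gb_O1_O2 ..
  · exact (gb_E_O2 ..).symm
  · exact (gb_O1_O2 ..).symm
  · left; simp [smul_mul_smul_comm, O2_O2]

lemma good_eval (p q : F) (t : BTree) :
    Good p q t.leaves.length (t.evalR p q).1 (t.evalR p q).2 := by
  induction t with
  | leaf i =>
    fin_cases i
    · right; right; left
      exact ⟨0, 1, by simp [BTree.leaves], by simp [BTree.evalR, genP, x1P],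
        by simp [BTree.evalR, genP, x1P, O1]⟩
    · right; right; right
      exact ⟨0, 1, by simp [BTree.leaves], by simp [BTree.evalR, genP, x2P],
        by simp [BTree.evalR, genP, x2P, O2]⟩
  | node s t hs ht =>
    simp only [BTree.leaves, List.length_append]
    exact good_bracket hs ht

end Helpers

theorem stmt16 {F : Type*} [Field F] [CharZero F] (p12 p21 : F)
    (h12 : p12 ≠ 0) (h21 : p21 ≠ 0) (k : ℕ) (hk : 0 < k) (t : BTree) :
    (t.leaves.length = 2 * k →
      ∃ α : F, (t.evalR p12 p21).2 =
        α • (p12 ^ k • ((X1 F * X2 F) ^ k) - p21 ^ k • ((X2 F * X1 F) ^ k))) ∧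
    (t.leaves.length = 2 * k + 1 →
      ∃ β : F, (t.evalR p12 p21).2 = β • ((X1 F * X2 F) ^ k * X1 F) ∨
        (t.evalR p12 p21).2 = β • (X2 F * (X1 F * X2 F) ^ k)) := by
  have h := good_eval p12 p21 t
  constructor
  · intro hn
    rcases h with h | ⟨l, c, h1, -, h3⟩ | ⟨l, c, h1, -, h3⟩ | ⟨l, c, h1, -, h3⟩
    · exact ⟨0, by rw [h, zero_smul]⟩
    · obtain rfl : k = l + 1 := by omega
      exact ⟨c, h3⟩
    · omega
    · omega
  · intro hn
    rcases h with h | ⟨l, c, h1, -, h3⟩ | ⟨l, c, h1, -, h3⟩ | ⟨l, c, h1, -, h3⟩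
    · exact ⟨0, Or.inl (by rw [h, zero_smul])⟩
    · omega
    · obtain rfl : k = l := by omega
      exact ⟨c, Or.inl h3⟩
    · obtain rfl : k = l := by omega
      exact ⟨c, Or.inr h3⟩
end

section
/- In the algebra A of the context, let k > 0, let x_{i_1}, …, x_{i_N} be any sequence of letters from {x1, x2}, and let σ be any full parenthesization (planar binary tree evaluation) of this sequence using the graded L-bracket [·,·]_L of the context. If N = 2k, then there exists α ∈ F such that σ(x_{i_1},…,x_{i_{2k}}) = α·(p21^{k}·(x1 x2)^{k} − p12^{k}·(x2 x1)^{k}). If N = 2k+1, then there exists β ∈ F such that σ(x_{i_1},…,x_{i_{2k+1}}) = β·(x1 x2)^{k} x1 or σ(x_{i_1},…,x_{i_{2k+1}}) = β·x2 (x1 x2)^{k}. -/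
/-- Evaluation of a full parenthesization (planar binary tree) using the graded
L-bracket, computed together with its degree. -/
noncomputable def BTree.evalL {F : Type*} [Field F] (p12 p21 : F) :
    BTree → (ℤ × ℤ) × QAlg F
  | .leaf i => genP F i
  | .node s t => brL p12 p21 (s.evalL p12 p21) (t.evalL p12 p21)

section aux
variable {R : Type*} [Ring R] {x y : R}

theorem aux_shift (x y : R) (k : ℕ) : x * (y * x) ^ k = (x * y) ^ k * x := by
  induction k with
  | zero => simp
  | succ k ih => rw [pow_succ, ← mul_assoc, ih, pow_succ]; simp only [mul_assoc]

/-- (xy)^(k+1) * (yx)^(l+1) = 0 when y² = 0 -/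
theorem aux_MN (hy : y * y = 0) (k l : ℕ) : (x * y) ^ (k+1) * (y * x) ^ (l+1) = 0 := by
  have : (x * y) ^ (k+1) * (y * x) ^ (l+1) = (x*y)^k * x * (y * y) * x * (y*x)^l := by
    rw [pow_succ, pow_succ' (y*x)]; simp only [mul_assoc]
  rw [this, hy]; simp

theorem aux_MP (k l : ℕ) : (x * y) ^ k * ((x * y) ^ l * x) = (x*y)^(k+l) * x := by
  rw [← mul_assoc, pow_add]

theorem aux_NP (hx : x * x = 0) (k l : ℕ) : (y * x) ^ (k+1) * ((x * y) ^ l * x) = 0 := by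
  have : (y * x) ^ (k+1) * ((x * y) ^ l * x) = (y*x)^k * y * (x * x) * (y*x)^l := by
    rw [← aux_shift, pow_succ]; simp only [mul_assoc]
  rw [this, hx]; simp

theorem aux_PM (hx : x * x = 0) (k l : ℕ) : ((x * y) ^ l * x) * (x * y) ^ (k+1) = 0 := by
  have : ((x * y) ^ l * x) * (x * y) ^ (k+1) = (x * y) ^ l * (x * x) * y * (x * y) ^ k := by
    rw [pow_succ']; simp only [mul_assoc]
  rw [this, hx]; simp

theorem aux_PN (k l : ℕ) : ((x * y) ^ l * x) * (y * x) ^ k = (x * y) ^ (k+l) * x := by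
  rw [mul_assoc, aux_shift, ← mul_assoc, ← pow_add, add_comm]

theorem aux_PP (hx : x * x = 0) (k l : ℕ) : ((x * y) ^ l * x) * ((x * y) ^ k * x) = 0 := by
  have : ((x * y) ^ l * x) * ((x * y) ^ k * x) = (x * y) ^ l * (x * x) * (y * x) ^ k := by
    rw [← aux_shift x y k]; simp only [mul_assoc]
  rw [this, hx]; simp

theorem aux_PQ (k l : ℕ) : ((x * y) ^ k * x) * ((y * x) ^ l * y) = (x * y) ^ (k+l+1) := by
  rw [← aux_shift y x, show k + l + 1 = k + (1 + l) by ring, pow_add, pow_add, pow_one]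
  simp only [mul_assoc]

end aux

theorem bichar_even {F : Type*} [Field F] (p12 p21 : F) (k l : ℕ) :
    bichar p12 p21 ((k:ℤ)+1, (k:ℤ)+1) ((l:ℤ)+1, (l:ℤ)+1)
      = bichar p12 p21 ((l:ℤ)+1, (l:ℤ)+1) ((k:ℤ)+1, (k:ℤ)+1) := by
  simp only [bichar]
  rw [mul_comm ((k:ℤ)+1)]

theorem bichar_odd {F : Type*} [Field F] (p12 p21 : F) (k l : ℕ) :
    ∃ s : F, bichar p12 p21 ((l:ℤ), (l:ℤ)+1) ((k:ℤ)+1, (k:ℤ)) = s * p21 ^ (k+l+1) ∧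
      bichar p12 p21 ((k:ℤ)+1, (k:ℤ)) ((l:ℤ), (l:ℤ)+1) = s * p12 ^ (k+l+1) := by
  refine ⟨(-1)^(l*(k+1)) * (-1)^((l+1)*k) * p12^(l*k) * p21^(l*k), ?_, ?_⟩
  · simp only [bichar]
    generalize (-1 : F) = c
    norm_cast
    ring
  · simp only [bichar]
    generalize (-1 : F) = c
    norm_cast
    ring

def Inv17 {F : Type*} [Field F] (p12 p21 : F) (n : ℕ) (u : (ℤ × ℤ) × QAlg F) : Prop :=
  u.2 = 0 ∨
  (∃ k : ℕ, n = 2 * (k+1) ∧ u.1 = ((k:ℤ)+1, (k:ℤ)+1) ∧ ∃ a : F,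
    u.2 = a • (p21 ^ (k+1) • ((X1 F * X2 F) ^ (k+1)) - p12 ^ (k+1) • ((X2 F * X1 F) ^ (k+1)))) ∨
  (∃ k : ℕ, n = 2 * k + 1 ∧ u.1 = ((k:ℤ)+1, (k:ℤ)) ∧ ∃ a : F,
    u.2 = a • ((X1 F * X2 F) ^ k * X1 F)) ∨
  (∃ k : ℕ, n = 2 * k + 1 ∧ u.1 = ((k:ℤ), (k:ℤ)+1) ∧ ∃ a : F,
    u.2 = a • ((X2 F * X1 F) ^ k * X2 F))

theorem Inv17.symm {F : Type*} [Field F] {p12 p21 : F} {n m : ℕ} {u v : (ℤ × ℤ) × QAlg F}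
    (h : Inv17 p12 p21 (m + n) (brL p12 p21 v u)) : Inv17 p12 p21 (n + m) (brL p12 p21 u v) := by
  have h1 : (brL p12 p21 u v).1 = (brL p12 p21 v u).1 := by simp [brL, add_comm]
  have h2 : (brL p12 p21 u v).2 = -(brL p12 p21 v u).2 := by simp [brL]
  unfold Inv17 at *
  rw [h1, h2, add_comm n m]
  rcases h with h | ⟨k, hk, hd, a, h⟩ | ⟨k, hk, hd, a, h⟩ | ⟨k, hk, hd, a, h⟩
  · left; rw [h, neg_zero]
  · exact Or.inr (Or.inl ⟨k, hk, hd, -a, by rw [h]; exact (neg_smul (R := F) (M := QAlg F) a _).symm⟩)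
  · exact Or.inr (Or.inr (Or.inl ⟨k, hk, hd, -a, by rw [h]; exact (neg_smul (R := F) (M := QAlg F) a _).symm⟩))
  · exact Or.inr (Or.inr (Or.inr ⟨k, hk, hd, -a, by rw [h]; exact (neg_smul (R := F) (M := QAlg F) a _).symm⟩))

theorem Inv17.br {F : Type*} [Field F] {p12 p21 : F} {n m : ℕ} {u v : (ℤ × ℤ) × QAlg F}
    (hu : Inv17 p12 p21 n u) (hv : Inv17 p12 p21 m v) :
    Inv17 p12 p21 (n + m) (brL p12 p21 u v) := by
  have hx := X1_sq F
  have hy := X2_sq F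
  have EP : ∀ {n m : ℕ} {u v : (ℤ × ℤ) × QAlg F}, 
      (∃ k : ℕ, n = 2 * (k+1) ∧ u.1 = ((k:ℤ)+1, (k:ℤ)+1) ∧ ∃ a : F,
      u.2 = a • (p21 ^ (k+1) • ((X1 F * X2 F) ^ (k+1)) - p12 ^ (k+1) • ((X2 F * X1 F) ^ (k+1)))) →
      (∃ k : ℕ, m = 2 * k + 1 ∧ v.1 = ((k:ℤ)+1, (k:ℤ)) ∧ ∃ a : F,
      v.2 = a • ((X1 F * X2 F) ^ k * X1 F)) → Inv17 p12 p21 (n + m) (brL p12 p21 u v) := by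
    rintro n m ⟨d, u⟩ ⟨e, v⟩ ⟨k, rfl, hd, a, h⟩ ⟨l, rfl, he, b, h'⟩
    dsimp only at hd he h h'
    subst hd he h h'
    refine Or.inr (Or.inr (Or.inl ⟨k+1+l, by ring, ?_, ?_⟩))
    · simp only [brL, Prod.mk_add_mk, Prod.mk.injEq]; push_cast; constructor <;> ring
    · simp only [brL, smul_mul_assoc, mul_smul_comm, sub_mul, mul_sub, aux_MP, aux_NP hx,
        aux_PM hx, aux_PN, smul_zero, sub_zero, zero_sub, smul_neg, smul_smul, ← sub_smul, ← neg_smul]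
      exact ⟨_, rfl⟩
  have EQ : ∀ {n m : ℕ} {u v : (ℤ × ℤ) × QAlg F}, 
      (∃ k : ℕ, n = 2 * (k+1) ∧ u.1 = ((k:ℤ)+1, (k:ℤ)+1) ∧ ∃ a : F,
      u.2 = a • (p21 ^ (k+1) • ((X1 F * X2 F) ^ (k+1)) - p12 ^ (k+1) • ((X2 F * X1 F) ^ (k+1)))) →
      (∃ k : ℕ, m = 2 * k + 1 ∧ v.1 = ((k:ℤ), (k:ℤ)+1) ∧ ∃ a : F,
      v.2 = a • ((X2 F * X1 F) ^ k * X2 F)) → Inv17 p12 p21 (n + m) (brL p12 p21 u v) := by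
    rintro n m ⟨d, u⟩ ⟨e, v⟩ ⟨k, rfl, hd, a, h⟩ ⟨l, rfl, he, b, h'⟩
    dsimp only at hd he h h'
    subst hd he h h'
    refine Or.inr (Or.inr (Or.inr ⟨k+1+l, by ring, ?_, ?_⟩))
    · simp only [brL, Prod.mk_add_mk, Prod.mk.injEq]; push_cast; constructor <;> ring
    · simp only [brL, smul_mul_assoc, mul_smul_comm, sub_mul, mul_sub, aux_MP, aux_NP hy,
        aux_PM hy, aux_PN, smul_zero, sub_zero, zero_sub, smul_neg, smul_smul, ← sub_smul, ← neg_smul]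
      exact ⟨_, rfl⟩
  have PQ : ∀ {n m : ℕ} {u v : (ℤ × ℤ) × QAlg F}, 
      (∃ k : ℕ, n = 2 * k + 1 ∧ u.1 = ((k:ℤ)+1, (k:ℤ)) ∧ ∃ a : F,
      u.2 = a • ((X1 F * X2 F) ^ k * X1 F)) →
      (∃ k : ℕ, m = 2 * k + 1 ∧ v.1 = ((k:ℤ), (k:ℤ)+1) ∧ ∃ a : F,
      v.2 = a • ((X2 F * X1 F) ^ k * X2 F)) → Inv17 p12 p21 (n + m) (brL p12 p21 u v) := by
    rintro n m ⟨d, u⟩ ⟨e, v⟩ ⟨k, rfl, hd, a, h⟩ ⟨l, rfl, he, b, h'⟩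
    dsimp only at hd he h h'
    subst hd he h h'
    refine Or.inr (Or.inl ⟨k+l, by ring, ?_, ?_⟩)
    · simp only [brL, Prod.mk_add_mk, Prod.mk.injEq]; push_cast; constructor <;> ring
    · obtain ⟨s, h1, h2⟩ := bichar_odd p12 p21 k l
      refine ⟨s * a * b, ?_⟩
      simp only [brL, smul_mul_assoc, mul_smul_comm, aux_PQ, h1, h2, smul_smul, smul_sub,
        add_comm l k]
      congr 2 <;> ring
  rcases hu with hu | hu | hu | hu
  · left; simp [brL, hu]
  · rcases hv with hv | hv | hv | hv
    · left; simp [brL, hv]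
    · left
      obtain ⟨d, u⟩ := u
      obtain ⟨e, v⟩ := v
      obtain ⟨k, rfl, hd, a, h⟩ := hu
      obtain ⟨l, rfl, he, b, h'⟩ := hv
      dsimp only at hd he h h'
      subst hd he h h'
      simp only [brL, bichar_even p12 p21 k l, ← smul_sub, smul_mul_assoc, mul_smul_comm,
        sub_mul, mul_sub, aux_MN hx, aux_MN hy, ← pow_add, add_comm (l+1) (k+1), smul_zero, 
        sub_zero, zero_sub, smul_neg, smul_smul, mul_comm b a, sub_neg_eq_add]
      rw [sub_eq_zero]
      simp only [smul_add, smul_smul]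
      congr 2 <;> ring
    · exact EP hu hv
    · exact EQ hu hv
  · rcases hv with hv | hv | hv | hv
    · left; simp [brL, hv]
    · exact (EP hv hu).symm
    · obtain ⟨k, -, -, a, h⟩ := hu
      obtain ⟨l, -, -, b, h'⟩ := hv
      left; simp [brL, h, h', aux_PP hx]
    · exact PQ hu hv
  · rcases hv with hv | hv | hv | hv
    · left; simp [brL, hv]
    · exact (EQ hv hu).symm
    · exact (PQ hv hu).symm
    · obtain ⟨k, -, -, a, h⟩ := hu
      obtain ⟨l, -, -, b, h'⟩ := hv
      left; simp [brL, h, h', aux_PP hy]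

theorem inv17_eval {F : Type*} [Field F] (p12 p21 : F) (t : BTree) :
    Inv17 p12 p21 t.leaves.length (t.evalL p12 p21) := by
  induction t with
  | leaf i =>
    simp only [BTree.leaves, BTree.evalL, genP]
    split_ifs
    · exact Or.inr (Or.inr (Or.inl ⟨0, by simp, by simp [x1P], 1, by simp [x1P]⟩))
    · exact Or.inr (Or.inr (Or.inr ⟨0, by simp, by simp [x2P], 1, by simp [x2P]⟩))
  | node s t hs ht =>
    simp only [BTree.leaves, BTree.evalL, List.length_append]
    exact hs.br ht

theorem stmt17 {F : Type*} [Field F] [CharZero F] (p12 p21 : F)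
    (h12 : p12 ≠ 0) (h21 : p21 ≠ 0) (k : ℕ) (hk : 0 < k) (t : BTree) :
    (t.leaves.length = 2 * k →
      ∃ α : F, (t.evalL p12 p21).2 =
        α • (p21 ^ k • ((X1 F * X2 F) ^ k) - p12 ^ k • ((X2 F * X1 F) ^ k))) ∧
    (t.leaves.length = 2 * k + 1 →
      ∃ β : F, (t.evalL p12 p21).2 = β • ((X1 F * X2 F) ^ k * X1 F) ∨
        (t.evalL p12 p21).2 = β • (X2 F * (X1 F * X2 F) ^ k)) := by


  have h := inv17_eval p12 p21 t
  constructor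
  · intro hn
    rw [hn] at h
    rcases h with h | ⟨l, hl, -, h⟩ | ⟨l, hl, -, h⟩ | ⟨l, hl, -, h⟩
    · exact ⟨0, by rw [h, zero_smul]⟩
    · obtain rfl : k = l + 1 := by omega
      exact h
    · omega
    · omega
  · intro hn
    rw [hn] at h
    rcases h with h | ⟨l, hl, -, h⟩ | ⟨l, hl, -, a, h⟩ | ⟨l, hl, -, a, h⟩
    · exact ⟨0, Or.inl (by rw [h, zero_smul])⟩
    · omega
    · obtain rfl : k = l := by omega
      exact ⟨a, Or.inl h⟩
    · obtain rfl : k = l := by omega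
      exact ⟨a, Or.inr (by rw [h, aux_shift])⟩
end
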